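/- In the greedy k-center process, if a ∈ A was never added to the greedy set B = {b_0,...,b_k} built with c-approximate furthest-point selection, and b_i, b_j ∈ B with i < j satisfy dist(b_i, b_j) ≤ 2r, then dist(a, B) ≤ 2cr. -/

import Mathlib

theorem stmt7 {M : Type*} [MetricSpace M] (k : ℕ) (A : Finset M)
    (c r : ℝ) (hc : 1 ≤ c) (b : Fin (k + 1) → M) (hb : ∀ i, b i ∈ A)
    (hgreedy : ∀ i : Fin (k + 1), 0 < i.val → ∀ a ∈ A,
      Metric.infDist a (b '' {m | m < i}) ≤ c * Metric.infDist (b i) (b '' {m | m < i}))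
    (a : M) (ha : a ∈ A) (hnot : a ∉ Set.range b)
    (i j : Fin (k + 1)) (hij : i < j) (hd : dist (b i) (b j) ≤ 2 * r) :
    Metric.infDist a (Set.range b) ≤ 2 * c * r := by
  have hmem : b i ∈ b '' {m | m < j} := ⟨i, hij, rfl⟩
  have hc0 : 0 ≤ c := zero_le_one.trans hc
  calc Metric.infDist a (Set.range b)
      ≤ Metric.infDist a (b '' {m | m < j}) :=
        Metric.infDist_le_infDist_of_subset (Set.image_subset_range _ _) ⟨_, hmem⟩
    _ ≤ c * Metric.infDist (b j) (b '' {m | m < j}) :=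
        hgreedy j (Nat.zero_lt_of_lt hij) a ha
    _ ≤ c * dist (b j) (b i) := by gcongr; exact Metric.infDist_le_dist_of_mem hmem
    _ ≤ c * (2 * r) := by rw [dist_comm]; gcongr
    _ = 2 * c * r := by ring
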